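/- arXiv:2106.12959 — 8 statements merged into one kernel-verified Lean document; each statement's English description precedes it below -/
import Mathlib

section
/- Let α ≥ 0 and 0 < φ < 1 satisfy (α+φ²)/(1−φ²) < 1/16. Let X be a finite multiset of points in ℝ^d that is φ-separated for k-means (k ≥ 2), let C* = {c*₁,…,c*_k} be an optimal k-means center set for X whose induced clusters X*₁,…,X*_k are all nonempty, and let Ĉ = (ĉ₁,…,ĉ_k) be any k centers with cost²_X(Ĉ) ≤ α·OPT²_{k−1}(X). Then there is a permutation π of {1,…,k} such that for every i, ‖ĉ_i − c*_{π(i)}‖ ≤ 2·√((α+φ²)/(1−φ²))·D_{π(i)}, where D_j = min_{l≠j} ‖c*_j − c*_l‖. -/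
open scoped BigOperators Classical

/-- The `p`-objective clustering cost of the multiset `X` w.r.t. the centers `C`. -/
noncomputable def kmcost (p : ℕ) {d k : ℕ} (X : Multiset (EuclideanSpace ℝ (Fin d)))
    (C : Fin k → EuclideanSpace ℝ (Fin d)) : ℝ :=
  (X.map fun x => ⨅ i, ‖x - C i‖ ^ p).sum

/-- The optimal `p`-objective `k`-clustering cost of the multiset `X`. -/
noncomputable def kmOPT (p : ℕ) {d : ℕ} (k : ℕ) (X : Multiset (EuclideanSpace ℝ (Fin d))) : ℝ :=
  ⨅ C : Fin k → EuclideanSpace ℝ (Fin d), kmcost p X C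

/-- `Dmin C i = min_{j ≠ i} ‖C i - C j‖`. -/
noncomputable def Dmin {d k : ℕ} (C : Fin k → EuclideanSpace ℝ (Fin d)) (i : Fin k) : ℝ :=
  ⨅ j : {j : Fin k // j ≠ i}, ‖C i - C j.1‖

/-- The mean of a finite multiset of points. -/
noncomputable def mmean {d : ℕ} (S : Multiset (EuclideanSpace ℝ (Fin d))) :
    EuclideanSpace ℝ (Fin d) :=
  (S.card : ℝ)⁻¹ • S.sum

lemma aux_cost_le {d k m : ℕ} (Xc : Fin k → Multiset (EuclideanSpace ℝ (Fin d)))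
    (C : Fin m → EuclideanSpace ℝ (Fin d)) (a : Fin k → Fin m) :
    kmcost 2 (∑ i, Xc i) C ≤ ∑ i, ((Xc i).map fun x => ‖x - C (a i)‖ ^ 2).sum := by
  have h : kmcost 2 (∑ i, Xc i) C = ∑ i, ((Xc i).map fun x => ⨅ i, ‖x - C i‖ ^ 2).sum := by
    unfold kmcost
    rw [← Multiset.coe_mapAddMonoidHom, map_sum, ← Multiset.coe_sumAddMonoidHom, map_sum]
  rw [h]
  refine Finset.sum_le_sum fun i _ => Multiset.sum_map_le_sum_map _ _ fun x _ => ?_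
  exact ciInf_le (Set.finite_range _).bddBelow (a i)

lemma aux_cost_eq {d k : ℕ} (Xc : Fin k → Multiset (EuclideanSpace ℝ (Fin d)))
    (C : Fin k → EuclideanSpace ℝ (Fin d)) :
    kmcost 2 (∑ i, Xc i) C = ∑ i, ((Xc i).map fun x => ⨅ i, ‖x - C i‖ ^ 2).sum := by
  unfold kmcost
  rw [← Multiset.coe_mapAddMonoidHom, map_sum, ← Multiset.coe_sumAddMonoidHom, map_sum]

lemma aux_cost_assign {d k : ℕ} (Xc : Fin k → Multiset (EuclideanSpace ℝ (Fin d)))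
    (C : Fin k → EuclideanSpace ℝ (Fin d))
    (h : ∀ i, ∀ x ∈ Xc i, ∀ j, ‖x - C i‖ ≤ ‖x - C j‖) :
    kmcost 2 (∑ i, Xc i) C = ∑ i, ((Xc i).map fun x => ‖x - C i‖ ^ 2).sum := by
  refine le_antisymm (aux_cost_le Xc C id) ?_
  rw [aux_cost_eq]
  refine Finset.sum_le_sum fun i _ => Multiset.sum_map_le_sum_map _ _ fun x hx => ?_
  have : Nonempty (Fin k) := ⟨i⟩
  exact le_ciInf fun j => by
    have := h i x hx j
    gcongr

lemma aux_cost_nonneg {d k : ℕ} (X : Multiset (EuclideanSpace ℝ (Fin d)))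
    (C : Fin k → EuclideanSpace ℝ (Fin d)) : 0 ≤ kmcost 2 X C := by
  unfold kmcost
  refine Multiset.sum_nonneg fun y hy => ?_
  obtain ⟨x, _, rfl⟩ := Multiset.mem_map.1 hy
  exact Real.iInf_nonneg fun i => by positivity

lemma aux_opt_le {d k : ℕ} (X : Multiset (EuclideanSpace ℝ (Fin d)))
    (C : Fin k → EuclideanSpace ℝ (Fin d)) : kmOPT 2 k X ≤ kmcost 2 X C :=
  ciInf_le ⟨0, by rintro _ ⟨C, rfl⟩; exact aux_cost_nonneg X C⟩ C

lemma aux_opt_nonneg {d k : ℕ} (X : Multiset (EuclideanSpace ℝ (Fin d))) :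
    0 ≤ kmOPT 2 k X :=
  Real.iInf_nonneg fun C => aux_cost_nonneg X C

lemma aux_shift {d : ℕ} (S : Multiset (EuclideanSpace ℝ (Fin d)))
    (c y : EuclideanSpace ℝ (Fin d)) :
    (S.map fun x => ‖x - y‖ ^ 2).sum = (S.map fun x => ‖x - c‖ ^ 2).sum
      + 2 * inner ℝ (S.sum - (S.card : ℝ) • c) (c - y) + S.card * ‖c - y‖ ^ 2 := by
  induction S using Multiset.induction_on with
  | empty => simp
  | cons a S ih =>
    simp only [Multiset.map_cons, Multiset.sum_cons, Multiset.card_cons, ih]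
    have h1 : ‖a - y‖ ^ 2 = ‖a - c‖ ^ 2 + 2 * inner ℝ (a - c) (c - y) + ‖c - y‖ ^ 2 := by
      rw [← norm_add_sq_real]; congr 2; abel
    have h2 : a + S.sum - ((S.card + 1 : ℕ) : ℝ) • c = (a - c) + (S.sum - (S.card : ℝ) • c) := by
      push_cast; rw [add_smul, one_smul]; abel
    rw [h1, h2, inner_add_left]
    push_cast
    ring

/-- Optimal centers: moving a cluster to `y` costs exactly `n ‖c - y‖²` more. -/
lemma aux_centroid {d : ℕ} (S : Multiset (EuclideanSpace ℝ (Fin d))) (hS : S ≠ 0)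
    (c : EuclideanSpace ℝ (Fin d))
    (h : ∀ y, (S.map fun x => ‖x - c‖ ^ 2).sum ≤ (S.map fun x => ‖x - y‖ ^ 2).sum)
    (y : EuclideanSpace ℝ (Fin d)) :
    (S.map fun x => ‖x - y‖ ^ 2).sum = (S.map fun x => ‖x - c‖ ^ 2).sum
      + S.card * ‖c - y‖ ^ 2 := by
  have hn : (0 : ℝ) < S.card := by exact_mod_cast Multiset.card_pos.2 hS
  set m : EuclideanSpace ℝ (Fin d) := (S.card : ℝ)⁻¹ • S.sum with hm
  have hm' : S.sum = (S.card : ℝ) • m := by rw [hm, smul_inv_smul₀ hn.ne']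
  have h1 := aux_shift S m c
  have h2 := h m
  rw [hm'] at h1
  simp only [sub_self, inner_zero_left, mul_zero, add_zero] at h1
  have h3 : (S.card : ℝ) * ‖m - c‖ ^ 2 ≤ 0 := by linarith
  have h4 : ‖m - c‖ ^ 2 ≤ 0 := by
    by_contra hc
    push Not at hc
    have := mul_pos hn hc
    linarith
  have h5 : m = c := by
    have : ‖m - c‖ = 0 := by nlinarith [norm_nonneg (m - c)]
    exact sub_eq_zero.1 (norm_eq_zero.1 this)
  have h6 := aux_shift S c y
  rw [hm', h5] at h6
  simpa using h6

lemma aux_sep {d k : ℕ} (hk : 2 ≤ k)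
    (Cstar : Fin k → EuclideanSpace ℝ (Fin d))
    (Xc : Fin k → Multiset (EuclideanSpace ℝ (Fin d)))
    (hopt : kmcost 2 (∑ i, Xc i) Cstar = kmOPT 2 k (∑ i, Xc i))
    (hassign : ∀ i, ∀ x ∈ Xc i, ∀ j, ‖x - Cstar i‖ ≤ ‖x - Cstar j‖)
    (hne : ∀ i, Xc i ≠ 0) (i : Fin k) :
    kmOPT 2 (k - 1) (∑ i, Xc i) ≤ kmOPT 2 k (∑ i, Xc i) + (Xc i).card * Dmin Cstar i ^ 2 := by
  have hcost := aux_cost_assign Xc Cstar hassign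
  have hsplit : ∀ F : Fin k → ℝ, ∑ j, F j = F i + ∑ j ∈ Finset.univ.erase i, F j :=
    fun F => (Finset.add_sum_erase _ _ (Finset.mem_univ i)).symm
  have hmin : ∀ y, ((Xc i).map fun x => ‖x - Cstar i‖ ^ 2).sum
      ≤ ((Xc i).map fun x => ‖x - y‖ ^ 2).sum := by
    intro y
    have h1 := aux_opt_le (∑ i, Xc i) (Function.update Cstar i y)
    have h2 := aux_cost_le Xc (Function.update Cstar i y) id
    rw [← hopt, hcost] at h1
    have h3 := h1.trans h2
    rw [hsplit, hsplit fun j =>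
      ((Xc j).map fun x => ‖x - Function.update Cstar i y (id j)‖ ^ 2).sum] at h3
    have h4 : ∑ j ∈ Finset.univ.erase i,
        ((Xc j).map fun x => ‖x - Function.update Cstar i y (id j)‖ ^ 2).sum
        = ∑ j ∈ Finset.univ.erase i, ((Xc j).map fun x => ‖x - Cstar j‖ ^ 2).sum := by
      refine Finset.sum_congr rfl fun j hj => ?_
      rw [id, Function.update_of_ne (Finset.ne_of_mem_erase hj)]
    rw [h4] at h3
    simp only [id, Function.update_self] at h3
    linarith
  obtain ⟨m, rfl⟩ : ∃ m, k = m + 1 := ⟨k - 1, by omega⟩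
  have : Nontrivial (Fin (m + 1)) := Fin.nontrivial_iff_two_le.2 hk
  have : Nonempty {j : Fin (m + 1) // j ≠ i} :=
    let ⟨j, hj⟩ := exists_ne i
    ⟨⟨j, hj⟩⟩
  obtain ⟨⟨j, hj⟩, hjD⟩ := exists_eq_ciInf_of_finite
    (f := fun j : {j : Fin (m + 1) // j ≠ i} => ‖Cstar i - Cstar j.1‖)
  have hD : Dmin Cstar i = ‖Cstar i - Cstar j‖ := hjD.symm
  have hex : ∀ l, ∃ b : Fin m, i.succAbove b = if l = i then j else l := by
    intro l
    apply Fin.exists_succAbove_eq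
    split_ifs with h
    · exact hj
    · exact h
  choose b hb using hex
  have h1 := aux_opt_le (∑ i, Xc i) (fun t => Cstar (i.succAbove t))
  have h2 := aux_cost_le Xc (fun t => Cstar (i.succAbove t)) b
  have h3 := h1.trans h2
  simp only [hb] at h3
  rw [hsplit] at h3
  have h4 : ∑ l ∈ Finset.univ.erase i,
      ((Xc l).map fun x => ‖x - Cstar (if l = i then j else l)‖ ^ 2).sum
      = ∑ l ∈ Finset.univ.erase i, ((Xc l).map fun x => ‖x - Cstar l‖ ^ 2).sum := by
    refine Finset.sum_congr rfl fun l hl => ?_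
    rw [if_neg (Finset.ne_of_mem_erase hl)]
  rw [h4, if_pos rfl, aux_centroid (Xc i) (hne i) _ hmin] at h3
  rw [← hopt, hcost, hsplit, hD]
  simp only [Nat.add_sub_cancel]
  linarith

/-- Theorem 5.1 of Ostrovsky et al. for `k`-means: if `X` is `φ`-separated and `Ĉ` has
`k`-means cost at most `α · OPT²_{k-1}(X)`, then the centers of `Ĉ` match the optimal centers
up to distance `2·√((α+φ²)/(1-φ²))·D_i`. -/
theorem stmt0 {d k : ℕ} (hk : 2 ≤ k) (α φ : ℝ) (hα : 0 ≤ α) (hφ0 : 0 < φ) (hφ1 : φ < 1)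
    (hcond : (α + φ ^ 2) / (1 - φ ^ 2) < 1 / 16)
    (X : Multiset (EuclideanSpace ℝ (Fin d)))
    (Cstar : Fin k → EuclideanSpace ℝ (Fin d)) (hinj : Function.Injective Cstar)
    (hopt : kmcost 2 X Cstar = kmOPT 2 k X)
    (hsep : kmOPT 2 k X ≤ φ ^ 2 * kmOPT 2 (k - 1) X)
    (Xc : Fin k → Multiset (EuclideanSpace ℝ (Fin d)))
    (hpart : ∑ i, Xc i = X)
    (hassign : ∀ i, ∀ x ∈ Xc i, ∀ j, ‖x - Cstar i‖ ≤ ‖x - Cstar j‖)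
    (hne : ∀ i, Xc i ≠ 0)
    (Chat : Fin k → EuclideanSpace ℝ (Fin d))
    (hChat : kmcost 2 X Chat ≤ α * kmOPT 2 (k - 1) X) :
    ∃ π : Equiv.Perm (Fin k), ∀ i,
      ‖Chat i - Cstar (π i)‖ ≤
        2 * Real.sqrt ((α + φ ^ 2) / (1 - φ ^ 2)) * Dmin Cstar (π i) := by
  subst hpart
  set O := kmOPT 2 (k - 1) (∑ i, Xc i) with hO
  have hO0 : 0 ≤ O := aux_opt_nonneg _
  set ρ := (α + φ ^ 2) / (1 - φ ^ 2) with hρ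
  have hφ2 : 0 < 1 - φ ^ 2 := by nlinarith
  have hρ0 : 0 < ρ := by rw [hρ]; positivity
  have hρm : ρ * (1 - φ ^ 2) = α + φ ^ 2 := by rw [hρ]; field_simp
  have hs0 : 0 < Real.sqrt ρ := Real.sqrt_pos.2 hρ0
  have hs2 : Real.sqrt ρ ^ 2 = ρ := Real.sq_sqrt hρ0.le
  have hs4 : 4 * Real.sqrt ρ < 1 := by nlinarith
  have hkpos : 0 < k := by omega
  have : Nonempty (Fin k) := ⟨⟨0, hkpos⟩⟩
  have hDn : ∀ i, 0 ≤ Dmin Cstar i := fun i => Real.iInf_nonneg fun _ => norm_nonneg _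
  have hDle : ∀ i j, j ≠ i → Dmin Cstar i ≤ ‖Cstar i - Cstar j‖ := fun i j hj =>
    ciInf_le (f := fun j : {j : Fin k // j ≠ i} => ‖Cstar i - Cstar j.1‖)
      (Set.finite_range _).bddBelow ⟨j, hj⟩
  have hclose : ∀ i, ∃ j, ‖Chat j - Cstar i‖ ≤ 2 * Real.sqrt ρ * Dmin Cstar i := by
    intro i
    by_contra hcon
    push Not at hcon
    have hsepi := aux_sep hk Cstar Xc hopt hassign hne i
    rw [← hO] at hsepi
    have hn : (0 : ℝ) < (Xc i).card := by exact_mod_cast Multiset.card_pos.2 (hne i)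
    -- the two cluster costs
    have hA : ((Xc i).map fun x => ⨅ j, ‖x - Chat j‖ ^ 2).sum ≤ α * O := by
      refine le_trans ?_ hChat
      rw [aux_cost_eq]
      refine Finset.single_le_sum
        (f := fun i => ((Xc i).map fun x => ⨅ j, ‖x - Chat j‖ ^ 2).sum) ?_ (Finset.mem_univ i)
      exact fun l _ => aux_cost_nonneg (Xc l) Chat
    have hB : ((Xc i).map fun x => ‖x - Cstar i‖ ^ 2).sum ≤ φ ^ 2 * O := by
      refine le_trans ?_ hsep
      rw [← hopt, aux_cost_assign Xc Cstar hassign]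
      refine Finset.single_le_sum
        (f := fun i => ((Xc i).map fun x => ‖x - Cstar i‖ ^ 2).sum) ?_ (Finset.mem_univ i)
      intro l _
      refine Multiset.sum_nonneg fun y hy => ?_
      obtain ⟨x, _, rfl⟩ := Multiset.mem_map.1 hy
      positivity
    have hpt : ∀ x ∈ Xc i, 2 * ρ * Dmin Cstar i ^ 2
        < (⨅ j, ‖x - Chat j‖ ^ 2) + ‖x - Cstar i‖ ^ 2 := by
      intro x _
      obtain ⟨j, hj⟩ := exists_eq_ciInf_of_finite (f := fun j => ‖x - Chat j‖ ^ 2)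
      rw [← hj]
      have h1 := hcon j
      have h2 : ‖Chat j - Cstar i‖ ≤ ‖x - Chat j‖ + ‖x - Cstar i‖ := by
        have := norm_sub_le (x - Cstar i) (x - Chat j)
        rw [sub_sub_sub_cancel_left] at this
        linarith
      have h3 : (2 * Real.sqrt ρ * Dmin Cstar i) ^ 2 < (‖x - Chat j‖ + ‖x - Cstar i‖) ^ 2 := by
        have : 0 ≤ 2 * Real.sqrt ρ * Dmin Cstar i := by have := hDn i; positivity
        have h12 := h1.trans_le h2
        gcongr
      rw [mul_pow, mul_pow, hs2] at h3
      nlinarith [sq_nonneg (‖x - Chat j‖ - ‖x - Cstar i‖)]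
    have hsum := Multiset.sum_lt_sum_of_nonempty (hne i) hpt
    rw [Multiset.sum_map_add, Multiset.map_const', Multiset.sum_replicate, nsmul_eq_mul] at hsum
    have h5 : (1 - φ ^ 2) * O ≤ (Xc i).card * Dmin Cstar i ^ 2 := by linarith
    have h6 : 2 * (α + φ ^ 2) * O ≤ (Xc i).card * (2 * ρ * Dmin Cstar i ^ 2) := by
      have := mul_le_mul_of_nonneg_left h5 hρ0.le
      rw [← mul_assoc, hρm] at this
      linarith
    have h7 : 0 ≤ (α + φ ^ 2) * O := by positivity
    linarith
  choose f hf using hclose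
  have hfinj : Function.Injective f := by
    intro a b hab
    by_contra hne'
    apply hne'
    apply hinj
    have h1 := hf a
    have h2 := hf b
    rw [← hab] at h2
    have h3 := hDle a b (Ne.symm hne')
    have h4 := hDle b a hne'
    rw [norm_sub_rev (Cstar b)] at h4
    have h5 := norm_sub_le (Chat (f a) - Cstar b) (Chat (f a) - Cstar a)
    rw [sub_sub_sub_cancel_left] at h5
    have h6 : ‖Cstar a - Cstar b‖ = 0 := by
      have := norm_nonneg (Cstar a - Cstar b)
      have e1 := mul_le_mul_of_nonneg_left h3 hs0.le
      have e2 := mul_le_mul_of_nonneg_left h4 hs0.le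
      nlinarith
    exact sub_eq_zero.1 (norm_eq_zero.1 h6)
  let e : Equiv.Perm (Fin k) := Equiv.ofBijective f (Finite.injective_iff_bijective.1 hfinj)
  refine ⟨e.symm, fun i => ?_⟩
  have := hf (e.symm i)
  rwa [show f (e.symm i) = i from e.apply_symm_apply i] at this
end

section
/- (Center-deletion stability implies center separation.) Let p ∈ {1,2}, let X be a finite multiset of points in ℝ^d with k ≥ 2, and let C* = {c*₁,…,c*_k} be an optimal center set for the p-objective with induced clusters X*₁,…,X*_k, where in the case p = 2 each c*_i is additionally assumed to equal the mean of its cluster X*_i. Suppose X is β-center-deletion stable for some β > 1: for every i and every j ≠ i, ∑_{x∈X*_i} ‖x − c*_j‖^p + ∑_{l≠i} ∑_{x∈X*_l} ‖x − c*_l‖^p ≥ β·OPT^p_k(X). Then for every i, |X*_i|·D_i^p ≥ (β−1)·OPT^p_k(X), where D_i = min_{j≠i} ‖c*_i − c*_j‖; i.e., X is (β−1)-center-separated. -/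
open scoped BigOperators Classical

theorem aux_sq {d : ℕ} (a b : EuclideanSpace ℝ (Fin d)) (S : Multiset (EuclideanSpace ℝ (Fin d))) :
    (S.map fun x => ‖x - b‖ ^ 2).sum = (S.map fun x => ‖x - a‖ ^ 2).sum
      + (S.card : ℝ) * ‖a - b‖ ^ 2 + 2 * inner ℝ (S.sum - (S.card : ℝ) • a) (a - b) := by
  induction S using Multiset.induction_on with
  | empty => simp
  | cons x S ih =>
    have h1 : ‖x - b‖ ^ 2 = ‖x - a‖ ^ 2 + 2 * inner ℝ (x - a) (a - b) + ‖a - b‖ ^ 2 := by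
      rw [← norm_add_sq_real]; congr 2; abel
    have h2 : (x ::ₘ S).sum - ((x ::ₘ S).card : ℝ) • a
        = (x - a) + (S.sum - (S.card : ℝ) • a) := by
      rw [Multiset.sum_cons, Multiset.card_cons]; push_cast; rw [add_smul, one_smul]; abel
    rw [h2, inner_add_left, Multiset.map_cons, Multiset.map_cons, Multiset.sum_cons,
      Multiset.sum_cons, ih, h1, Multiset.card_cons]
    push_cast; ring

theorem aux_one {d : ℕ} (a b : EuclideanSpace ℝ (Fin d)) (S : Multiset (EuclideanSpace ℝ (Fin d))) :
    (S.map fun x => ‖x - b‖ ^ 1).sum ≤ (S.map fun x => ‖x - a‖ ^ 1).sum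
      + (S.card : ℝ) * ‖a - b‖ ^ 1 := by
  induction S using Multiset.induction_on with
  | empty => simp
  | cons x S ih =>
    have h1 := norm_sub_le_norm_sub_add_norm_sub x a b
    simp only [Multiset.map_cons, Multiset.sum_cons, Multiset.card_cons, pow_one] at *
    push_cast; linarith

theorem aux_mean {d : ℕ} (S : Multiset (EuclideanSpace ℝ (Fin d))) :
    S.sum - (S.card : ℝ) • mmean S = 0 := by
  by_cases h : S = 0
  · subst h; simp
  · have : (S.card : ℝ) ≠ 0 := by simpa using h
    rw [mmean, smul_inv_smul₀ this, sub_self]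

theorem aux_cost {d k : ℕ} (p : ℕ)
    (C : Fin k → EuclideanSpace ℝ (Fin d)) 
    (Xc : Fin k → Multiset (EuclideanSpace ℝ (Fin d)))
    (hassign : ∀ i, ∀ x ∈ Xc i, ∀ j, ‖x - C i‖ ≤ ‖x - C j‖) :
    kmcost p (∑ i, Xc i) C = ∑ l, ((Xc l).map fun x => ‖x - C l‖ ^ p).sum := by
  have h : ∀ s : Finset (Fin k), kmcost p (∑ i ∈ s, Xc i) C
      = ∑ l ∈ s, kmcost p (Xc l) C := by
    intro s
    induction s using Finset.induction_on with
    | empty => simp [kmcost]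
    | insert a s ha ih =>
      rw [Finset.sum_insert ha, Finset.sum_insert ha, ← ih]
      simp [kmcost]
  rw [h]
  refine Finset.sum_congr rfl fun l _ => ?_
  unfold kmcost
  congr 1
  refine Multiset.map_congr rfl fun x hx => ?_
  haveI : Nonempty (Fin k) := ⟨l⟩
  apply le_antisymm
  · exact ciInf_le (Set.finite_range _).bddBelow l
  · exact le_ciInf fun j => pow_le_pow_left₀ (norm_nonneg _) (hassign l x hx j) p

/-- `β`-center-deletion stability implies `(β-1)`-center separation. -/
theorem stmt3 {d k : ℕ} (hk : 2 ≤ k) (p : ℕ) (hp : p = 1 ∨ p = 2) (β : ℝ) (hβ : 1 < β)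
    (X : Multiset (EuclideanSpace ℝ (Fin d)))
    (Cstar : Fin k → EuclideanSpace ℝ (Fin d)) (hinj : Function.Injective Cstar)
    (hopt : kmcost p X Cstar = kmOPT p k X)
    (Xc : Fin k → Multiset (EuclideanSpace ℝ (Fin d)))
    (hpart : ∑ i, Xc i = X)
    (hassign : ∀ i, ∀ x ∈ Xc i, ∀ j, ‖x - Cstar i‖ ≤ ‖x - Cstar j‖)
    (hmean : p = 2 → ∀ i, Cstar i = mmean (Xc i))
    (hstab : ∀ i j, j ≠ i →
      ((Xc i).map fun x => ‖x - Cstar j‖ ^ p).sum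
        + ∑ l ∈ Finset.univ.erase i, ((Xc l).map fun x => ‖x - Cstar l‖ ^ p).sum
        ≥ β * kmOPT p k X) :
    ∀ i, ((Xc i).card : ℝ) * Dmin Cstar i ^ p ≥ (β - 1) * kmOPT p k X := by
  intro i
  haveI : Nontrivial (Fin k) := Fin.nontrivial_iff_two_le.mpr hk
  obtain ⟨j0, hj0⟩ := exists_ne i
  haveI : Nonempty {j : Fin k // j ≠ i} := ⟨⟨j0, hj0⟩⟩
  obtain ⟨⟨j, hj⟩, hD⟩ := exists_eq_ciInf_of_finite
    (f := fun j : {j : Fin k // j ≠ i} => ‖Cstar i - Cstar j.1‖)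
  have hD' : Dmin Cstar i = ‖Cstar i - Cstar j‖ := hD.symm
  have hc := aux_cost p Cstar Xc hassign
  rw [hpart, hopt, ← Finset.add_sum_erase _ _ (Finset.mem_univ i)] at hc
  have hs := hstab i j hj
  have key : ((Xc i).map fun x => ‖x - Cstar j‖ ^ p).sum
      ≤ ((Xc i).map fun x => ‖x - Cstar i‖ ^ p).sum
        + ((Xc i).card : ℝ) * ‖Cstar i - Cstar j‖ ^ p := by
    rcases hp with rfl | rfl
    · exact aux_one _ _ _
    · have h0 : (Xc i).sum - ((Xc i).card : ℝ) • Cstar i = 0 := by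
        rw [hmean rfl i]; exact aux_mean _
      rw [aux_sq (Cstar i) (Cstar j), h0, inner_zero_left]
      simp
  rw [hD']
  linarith
end

section
/- (Center separation implies approximation-center stability.) Let p ∈ {1,2}, let X be a finite multiset of points in ℝ^d with k ≥ 2, let C* = {c*₁,…,c*_k} be an optimal center set for the p-objective with induced clusters X*₁,…,X*_k, and let γ > 0 satisfy D_i^p ≥ (γ/|X*_i|)·OPT^p_k(X) for every i, where D_i = min_{j≠i} ‖c*_i − c*_j‖. Then for every set Ĉ of k centers such that for some index i one has min_{ĉ∈Ĉ} ‖c*_i − ĉ‖^p ≥ (1/4)·D_i^p, it holds that cost^p_X(Ĉ) ≥ (γ/(4p) − 1)·OPT^p_k(X). In particular, X is (γ/(4p) − 1, 1/4)-approximation-center stable. -/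
open scoped BigOperators Classical

/-- `γ`-center separation implies `(γ/(4p) - 1, 1/4)`-approximation-center stability. -/
theorem stmt4 {d k : ℕ} (hk : 2 ≤ k) (p : ℕ) (hp : p = 1 ∨ p = 2) (γ : ℝ) (hγ : 0 < γ)
    (X : Multiset (EuclideanSpace ℝ (Fin d)))
    (Cstar : Fin k → EuclideanSpace ℝ (Fin d)) (hinj : Function.Injective Cstar)
    (hopt : kmcost p X Cstar = kmOPT p k X)
    (Xc : Fin k → Multiset (EuclideanSpace ℝ (Fin d)))
    (hpart : ∑ i, Xc i = X)
    (hassign : ∀ i, ∀ x ∈ Xc i, ∀ j, ‖x - Cstar i‖ ≤ ‖x - Cstar j‖)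
    (hne : ∀ i, Xc i ≠ 0)
    (hcs : ∀ i, Dmin Cstar i ^ p ≥ (γ / ((Xc i).card : ℝ)) * kmOPT p k X) :
    ∀ Chat : Fin k → EuclideanSpace ℝ (Fin d),
      (∃ i, (1 / 4 : ℝ) * Dmin Cstar i ^ p ≤ ⨅ j, ‖Cstar i - Chat j‖ ^ p) →
      kmcost p X Chat ≥ (γ / (4 * (p : ℝ)) - 1) * kmOPT p k X := by
  rintro Chat ⟨i, hi⟩
  have hne' : Nonempty (Fin k) := ⟨i⟩
  set A : ℝ := (1 / 4 : ℝ) * Dmin Cstar i ^ p with hA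
  have hp0 : (0 : ℝ) < p := by rcases hp with rfl | rfl <;> norm_num
  let f : EuclideanSpace ℝ (Fin d) → ℝ := fun x => ⨅ j, ‖x - Chat j‖ ^ p
  let g : EuclideanSpace ℝ (Fin d) → ℝ := fun x => ⨅ j, ‖x - Cstar j‖ ^ p
  have hf0 : ∀ x, 0 ≤ f x := fun x => Real.iInf_nonneg fun j => by positivity
  have hg0 : ∀ x, 0 ≤ g x := fun x => Real.iInf_nonneg fun j => by positivity
  have hpt : ∀ x ∈ Xc i, A / p ≤ f x + g x := by
    intro x hx
    have h1 : ‖x - Cstar i‖ ^ p ≤ g x :=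
      le_ciInf fun j => pow_le_pow_left₀ (norm_nonneg _) (hassign i x hx j) p
    have h2 : A / p - ‖x - Cstar i‖ ^ p ≤ f x := by
      refine le_ciInf fun j => ?_
      have h3 : A ≤ ‖Cstar i - Chat j‖ ^ p :=
        hi.trans (ciInf_le (Set.finite_range _).bddBelow j)
      have h4 : ‖Cstar i - Chat j‖ ≤ ‖x - Cstar i‖ + ‖x - Chat j‖ := by
        have := norm_sub_le (x - Chat j) (x - Cstar i)
        rw [sub_sub_sub_cancel_left] at this
        linarith
      have h5 := pow_le_pow_left₀ (norm_nonneg _) h4 p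
      rw [sub_le_iff_le_add, div_le_iff₀ hp0]
      rcases hp with rfl | rfl
      · push_cast; linarith
      · push_cast
        nlinarith [sq_nonneg (‖x - Cstar i‖ - ‖x - Chat j‖)]
    linarith
  have hsplit : X = Xc i + ∑ j ∈ Finset.univ.erase i, Xc j := by
    rw [Finset.add_sum_erase _ _ (Finset.mem_univ i), hpart]
  have hsum : kmcost p X Chat + kmcost p X Cstar = (X.map fun x => f x + g x).sum := by
    rw [Multiset.sum_map_add]; rfl
  have hlow : ((Xc i).card : ℝ) * (A / p) ≤ ((Xc i).map fun x => f x + g x).sum := by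
    have := Multiset.card_nsmul_le_sum (s := (Xc i).map fun x => f x + g x) (a := A / p)
      (by
        intro y hy
        obtain ⟨x, hx, rfl⟩ := Multiset.mem_map.1 hy
        exact hpt x hx)
    simpa [nsmul_eq_mul] using this
  have hrest : 0 ≤ ((∑ j ∈ Finset.univ.erase i, Xc j).map fun x => f x + g x).sum := by
    refine Multiset.sum_nonneg fun y hy => ?_
    obtain ⟨x, hx, rfl⟩ := Multiset.mem_map.1 hy
    exact add_nonneg (hf0 x) (hg0 x)
  have htot : ((Xc i).card : ℝ) * (A / p) ≤ kmcost p X Chat + kmcost p X Cstar := by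
    rw [hsum, hsplit, Multiset.map_add, Multiset.sum_add]
    linarith
  have hcard : (0 : ℝ) < (Xc i).card := by
    exact_mod_cast Multiset.card_pos.2 (hne i)
  have hfin : γ / (4 * (p : ℝ)) * kmOPT p k X ≤ ((Xc i).card : ℝ) * (A / p) := by
    have h := mul_le_mul_of_nonneg_left (hcs i)
      (show (0 : ℝ) ≤ (Xc i).card / (4 * p) by positivity)
    calc _ = (Xc i).card / (4 * (p : ℝ)) * (γ / ((Xc i).card : ℝ) * kmOPT p k X) := by
          field_simp
      _ ≤ _ := h
      _ = _ := by rw [hA]; field_simp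
  rw [hopt] at htot
  linarith
end

section
/- (Approximation-center stability implies well-separability.) Let p ∈ {1,2}, let X be a finite multiset of points in ℝ^d with k ≥ 2, let δ > 1, and let C* = {c*₁,…,c*_k} be an optimal center set for the p-objective with D_i = min_{j≠i} ‖c*_i − c*_j‖. Suppose X is (δ, 1/4)-approximation-center stable: for every k-tuple (ĉ₁,…,ĉ_k) of points of ℝ^d with cost^p_X({ĉ₁,…,ĉ_k}) ≤ δ·OPT^p_k(X) there exists a permutation π of {1,…,k} such that ‖c*_i − ĉ_{π(i)}‖^p < (1/4)·D_i^p for all i. Then OPT^p_{k−1}(X) ≥ δ·OPT^p_k(X); i.e., X is δ^{−1/p}-well-separated. -/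
open scoped BigOperators Classical

/-- `(δ, 1/4)`-approximation-center stability implies `δ^{-1/p}`-well-separability, i.e.
`OPT_{k-1} ≥ δ · OPT_k`. -/
theorem stmt5 {d k : ℕ} (hk : 2 ≤ k) (p : ℕ) (hp : p = 1 ∨ p = 2) (δ : ℝ) (hδ : 1 < δ)
    (X : Multiset (EuclideanSpace ℝ (Fin d)))
    (Cstar : Fin k → EuclideanSpace ℝ (Fin d)) (hinj : Function.Injective Cstar)
    (hopt : kmcost p X Cstar = kmOPT p k X)
    (hstab : ∀ Chat : Fin k → EuclideanSpace ℝ (Fin d),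
      kmcost p X Chat ≤ δ * kmOPT p k X →
      ∃ π : Equiv.Perm (Fin k), ∀ i,
        ‖Cstar i - Chat (π i)‖ ^ p < (1 / 4 : ℝ) * Dmin Cstar i ^ p) :
    kmOPT p (k - 1) X ≥ δ * kmOPT p k X := by
  by_contra hlt
  rw [ge_iff_le, not_le] at hlt
  obtain ⟨C, hC⟩ := exists_lt_of_ciInf_lt (f := fun C : Fin (k - 1) → _ => kmcost p X C) hlt
  obtain ⟨m, rfl⟩ : ∃ m, k = m + 2 := ⟨k - 2, by omega⟩
  change Fin (m + 1) → EuclideanSpace ℝ (Fin d) at C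
  change kmcost p X C < _ at hC
  let g : Fin (m + 2) → Fin (m + 1) := Fin.cons 0 id
  have hg : Function.Surjective g := fun a => ⟨a.succ, by simp [g]⟩
  have hcost : kmcost p X (fun i => C (g i)) = kmcost p X C := by
    unfold kmcost
    congr 2
    funext x
    exact hg.iInf_comp (fun i => ‖x - C i‖ ^ p)
  obtain ⟨π, hπ⟩ := hstab (fun i => C (g i)) (by rw [hcost]; exact hC.le)
  have hD : ∀ i j, j ≠ i → Dmin Cstar i ≤ ‖Cstar i - Cstar j‖ := fun i j hij =>
    ciInf_le (f := fun j : {j : Fin (m + 2) // j ≠ i} => ‖Cstar i - Cstar j.1‖)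
      (Set.finite_range _).bddBelow ⟨j, hij⟩
  have hD0 : ∀ i, 0 ≤ Dmin Cstar i := fun i => Real.iInf_nonneg fun _ => norm_nonneg _
  have hij : π.symm 0 ≠ π.symm 1 := by simp
  have h0 := hπ (π.symm 0)
  have h1 := hπ (π.symm 1)
  have e0 : g 0 = 0 := rfl
  have e1 : g 1 = 0 := rfl
  simp only [Equiv.apply_symm_apply, e0, e1] at h0 h1
  generalize π.symm 0 = i at *
  generalize π.symm 1 = j at *
  have d1 := hD i j hij.symm
  have d2 := hD j i hij
  have t : ‖Cstar i - Cstar j‖ ≤ ‖Cstar i - C 0‖ + ‖Cstar j - C 0‖ := by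
    rw [norm_sub_rev (Cstar j) (C 0)]
    exact norm_sub_le_norm_sub_add_norm_sub _ _ _
  rw [norm_sub_rev (Cstar j) (Cstar i)] at d2
  have key : ∀ a D : ℝ, 0 ≤ D → a ^ p < 1 / 4 * D ^ p → a < D / 2 := by
    intro a D hD h
    rcases hp with rfl | rfl
    · simp only [pow_one] at h
      linarith
    · nlinarith
  have k0 := key _ _ (hD0 i) h0
  have k1 := key _ _ (hD0 j) h1
  linarith
end

section
/- Let 0 < φ < 1, w ≥ 0 satisfy φ²(w+1)/(1−φ²) ≤ 1/784, and set γ = 2·√(φ²(w+1)/(1−φ²)) and ρ = 100φ²/(1−φ²). Let X be a finite multiset of points in ℝ^d that is φ-separated for k-means (k ≥ 2), with optimal centers C* = {c*₁,…,c*_k} whose induced clusters X*₁,…,X*_k are all nonempty. Let B = {b₁,…,b_k} be centers with cost²_X(B) ≤ w·φ²·OPT²_{k−1}(X), indexed so that ‖b_i − c*_i‖ ≤ γ·D_i for every i. Define D̂_i = min_{j≠i} ‖b_i − b_j‖, X̂_i = {x ∈ X : ‖x − b_i‖ ≤ D̂_i/3}, and let c̄_i be the mean of X̂_i. Then each X̂_i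 is nonempty and for every i, ‖c̄_i − c*_i‖² ≤ (r*_i)²·ρ/(1−ρ). -/
open scoped BigOperators Classical

abbrev EE (d : ℕ) := EuclideanSpace ℝ (Fin d)

noncomputable def SS {d : ℕ} (M : Multiset (EE d)) (c : EE d) : ℝ :=
  (M.map fun x => ‖x - c‖ ^ 2).sum

lemma SS_nonneg {d : ℕ} (M : Multiset (EE d)) (c : EE d) : 0 ≤ SS M c := by
  apply Multiset.sum_nonneg
  intro y hy
  obtain ⟨x, -, rfl⟩ := Multiset.mem_map.1 hy
  positivity

lemma SS_add {d : ℕ} (M N : Multiset (EE d)) (c : EE d) : SS (M + N) c = SS M c + SS N c := by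
  simp [SS]

lemma SS_shift {d : ℕ} (M : Multiset (EE d)) (a c : EE d) :
    SS M c = SS M a + 2 * inner ℝ (M.sum - (M.card : ℝ) • a) (a - c) + M.card * ‖a - c‖ ^ 2 := by
  induction M using Multiset.induction_on with
  | empty => simp [SS]
  | cons x M ih =>
    have h1 : ∀ e, SS (x ::ₘ M) e = ‖x - e‖ ^ 2 + SS M e := by intro e; simp [SS]
    rw [h1, h1, ih]
    have h2 : ‖x - c‖ ^ 2 = ‖x - a‖ ^ 2 + 2 * inner ℝ (x - a) (a - c) + ‖a - c‖ ^ 2 := by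
      rw [← norm_add_sq_real]; congr 2; abel
    have h3 : (x ::ₘ M).sum - ((x ::ₘ M).card : ℝ) • a = (x - a) + (M.sum - (M.card : ℝ) • a) := by
      simp only [Multiset.sum_cons, Multiset.card_cons, Nat.cast_add, Nat.cast_one]
      module
    rw [h3, inner_add_left, h2, Multiset.card_cons]
    push_cast
    ring

lemma SS_mean {d : ℕ} (M : Multiset (EE d)) (a c : EE d) (h : M.sum = (M.card : ℝ) • a) :
    SS M c = SS M a + M.card * ‖a - c‖ ^ 2 := by
  rw [SS_shift M a c, h]; simp

lemma sum_eq_mmean {d : ℕ} (M : Multiset (EE d)) : M.sum = (M.card : ℝ) • mmean M := by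
  by_cases h : M = 0
  · simp [h]
  · have : (M.card : ℝ) ≠ 0 := by simpa using h
    rw [mmean, smul_inv_smul₀ this]

lemma cauchy {d : ℕ} (M : Multiset (EE d)) (c : EE d) :
    ‖M.sum - (M.card : ℝ) • c‖ ^ 2 ≤ M.card * SS M c := by
  have h := sum_eq_mmean M
  rw [SS_mean M _ c h]
  have : M.sum - (M.card : ℝ) • c = (M.card : ℝ) • (mmean M - c) := by
    rw [smul_sub, ← h]
  rw [this, norm_smul, mul_pow]
  have := SS_nonneg M (mmean M)
  have h2 : (0 : ℝ) ≤ M.card := by positivity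
  simp only [Real.norm_natCast]
  nlinarith [mul_nonneg h2 this]

lemma kmcost_add {d k : ℕ} (X Y : Multiset (EE d)) (C : Fin k → EE d) :
    kmcost 2 (X + Y) C = kmcost 2 X C + kmcost 2 Y C := by
  simp [kmcost]

lemma kmcost_sum {d k m : ℕ} (Y : Fin m → Multiset (EE d)) (C : Fin k → EE d) :
    kmcost 2 (∑ i, Y i) C = ∑ i, kmcost 2 (Y i) C := by
  induction (Finset.univ : Finset (Fin m)) using Finset.induction_on with
  | empty => simp [kmcost]
  | insert a s ha ih => rw [Finset.sum_insert ha, Finset.sum_insert ha, kmcost_add, ih]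

lemma kmcost_le_SS {d k : ℕ} (Y : Multiset (EE d)) (C : Fin k → EE d) (i : Fin k) :
    kmcost 2 Y C ≤ SS Y (C i) := by
  apply Multiset.sum_map_le_sum_map
  intro x _
  exact ciInf_le (Set.finite_range _).bddBelow i

lemma kmcost_eq_SS {d k : ℕ} (Y : Multiset (EE d)) (C : Fin k → EE d) (i : Fin k)
    (h : ∀ x ∈ Y, ∀ j, ‖x - C i‖ ≤ ‖x - C j‖) :
    kmcost 2 Y C = SS Y (C i) := by
  apply le_antisymm (kmcost_le_SS Y C i)
  apply Multiset.sum_map_le_sum_map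
  intro x hx
  have : Nonempty (Fin k) := ⟨i⟩
  apply le_ciInf
  intro j
  have := h x hx j
  gcongr

lemma kmcost_nonneg {d k : ℕ} (Y : Multiset (EE d)) (C : Fin k → EE d) : 0 ≤ kmcost 2 Y C := by
  apply Multiset.sum_nonneg
  intro y hy
  obtain ⟨x, -, rfl⟩ := Multiset.mem_map.1 hy
  exact Real.iInf_nonneg fun i => by positivity

lemma kmOPT_le {d k : ℕ} (Y : Multiset (EE d)) (C : Fin k → EE d) : kmOPT 2 k Y ≤ kmcost 2 Y C :=
  ciInf_le ⟨0, by rintro _ ⟨C, rfl⟩; exact kmcost_nonneg Y C⟩ C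

lemma kmOPT_le_sum {d k m : ℕ} (Y : Fin m → Multiset (EE d)) (C : Fin k → EE d)
    (f : Fin m → Fin k) : kmOPT 2 k (∑ i, Y i) ≤ ∑ i, SS (Y i) (C (f i)) := by
  refine (kmOPT_le _ C).trans ?_
  rw [kmcost_sum]
  exact Finset.sum_le_sum fun i _ => kmcost_le_SS _ _ _

lemma filter_sum' {d m : ℕ} (Y : Fin m → Multiset (EE d)) (p : EE d → Prop) (s : Finset (Fin m)) :
    (∑ j ∈ s, Y j).filter p = ∑ j ∈ s, (Y j).filter p := by
  induction s using Finset.induction_on with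
  | empty => simp
  | insert a s ha ih => rw [Finset.sum_insert ha, Finset.sum_insert ha, Multiset.filter_add, ih]

lemma Dmin_le {d k : ℕ} (C : Fin k → EE d) (i j : Fin k) (h : j ≠ i) :
    Dmin C i ≤ ‖C i - C j‖ :=
  ciInf_le (f := fun j : {j : Fin k // j ≠ i} => ‖C i - C j.1‖)
    (Set.finite_range _).bddBelow ⟨j, h⟩

lemma Dmin_attained {d k : ℕ} (hk : 2 ≤ k) (C : Fin k → EE d) (i : Fin k) :
    ∃ j, j ≠ i ∧ Dmin C i = ‖C i - C j‖ := by
  have : Nontrivial (Fin k) := Fin.nontrivial_iff_two_le.2 hk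
  obtain ⟨j0, hj0⟩ := exists_ne i
  have : Nonempty {j : Fin k // j ≠ i} := ⟨⟨j0, hj0⟩⟩
  obtain ⟨j, hj⟩ := exists_eq_ciInf_of_finite (f := fun j : {j : Fin k // j ≠ i} => ‖C i - C j.1‖)
  exact ⟨j.1, j.2, hj.symm⟩

lemma centroid {d k : ℕ} (Cs : Fin k → EE d) (Xc : Fin k → Multiset (EE d))
    (hopt : ∑ j, SS (Xc j) (Cs j) = kmOPT 2 k (∑ i, Xc i)) (i : Fin k) (hne : Xc i ≠ 0) :
    (Xc i).sum = ((Xc i).card : ℝ) • Cs i := by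
  have h1 := kmOPT_le_sum Xc (Function.update Cs i (mmean (Xc i))) id
  rw [← hopt] at h1
  rw [← Finset.add_sum_erase _ _ (Finset.mem_univ i),
    ← Finset.add_sum_erase _ (fun j => SS (Xc j) _) (Finset.mem_univ i)] at h1
  have h2 : ∑ x ∈ Finset.univ.erase i, SS (Xc x) (Function.update Cs i (mmean (Xc i)) (id x))
      = ∑ x ∈ Finset.univ.erase i, SS (Xc x) (Cs x) := by
    apply Finset.sum_congr rfl
    intro x hx
    rw [id, Function.update_of_ne (Finset.ne_of_mem_erase hx)]
  rw [h2] at h1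
  simp only [id, Function.update_self] at h1
  rw [SS_mean _ _ (Cs i) (sum_eq_mmean (Xc i))] at h1
  have hc : (0 : ℝ) < (Xc i).card := by
    exact_mod_cast Multiset.card_pos.2 hne
  have h3 : ‖mmean (Xc i) - Cs i‖ ^ 2 ≤ 0 := by
    by_contra h
    push Not at h
    nlinarith [mul_pos hc h]
  have h4 : mmean (Xc i) = Cs i := by
    have : ‖mmean (Xc i) - Cs i‖ = 0 := by nlinarith [norm_nonneg (mmean (Xc i) - Cs i)]
    exact sub_eq_zero.1 (norm_eq_zero.1 this)
  rw [← h4]; exact sum_eq_mmean _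

lemma merge {d k : ℕ} (hk : 2 ≤ k) (Cs : Fin k → EE d) (Xc : Fin k → Multiset (EE d)) (i : Fin k)
    (hmean : (Xc i).sum = ((Xc i).card : ℝ) • Cs i) :
    kmOPT 2 (k - 1) (∑ i, Xc i) ≤ ∑ j, SS (Xc j) (Cs j) + (Xc i).card * Dmin Cs i ^ 2 := by
  obtain ⟨j, hj, hD⟩ := Dmin_attained hk Cs i
  obtain ⟨m, rfl⟩ : ∃ m, k = m + 1 := ⟨k - 1, by omega⟩
  have key : ∀ l : Fin (m + 1), ∃ t : Fin m, i.succAbove t = if l = i then j else l := by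
    intro l
    apply Fin.exists_succAbove_eq
    split_ifs with h
    · exact hj
    · exact h
  choose f hf using key
  have h1 := kmOPT_le_sum Xc (fun t => Cs (i.succAbove t)) f
  refine h1.trans ?_
  simp only [hf]
  rw [← Finset.add_sum_erase _ _ (Finset.mem_univ i),
    ← Finset.add_sum_erase _ (fun j => SS (Xc j) _) (Finset.mem_univ i)]
  have h2 : ∑ x ∈ Finset.univ.erase i, SS (Xc x) (Cs (if x = i then j else x))
      = ∑ x ∈ Finset.univ.erase i, SS (Xc x) (Cs x) := by
    apply Finset.sum_congr rfl
    intro x hx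
    rw [if_neg (Finset.ne_of_mem_erase hx)]
  rw [h2, if_pos rfl, SS_mean _ _ (Cs j) hmean, hD]
  linarith

lemma submean {d : ℕ} (H R : Multiset (EE d)) (c : EE d)
    (hm : (H + R).sum = ((H + R).card : ℝ) • c) :
    (H.card + R.card : ℝ) * ‖H.sum - (H.card : ℝ) • c‖ ^ 2 ≤
      H.card * R.card * SS (H + R) c := by
  have e : R.sum - (R.card : ℝ) • c = -(H.sum - (H.card : ℝ) • c) := by
    rw [Multiset.sum_add, Multiset.card_add, Nat.cast_add, add_smul] at hm
    rw [eq_sub_of_add_eq' hm]; abel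
  have h1 := cauchy H c
  have h2 := cauchy R c
  rw [e, norm_neg] at h2
  have hh : (0 : ℝ) ≤ H.card := by positivity
  have hr : (0 : ℝ) ≤ R.card := by positivity
  rw [SS_add]
  nlinarith [mul_le_mul_of_nonneg_left h1 hr, mul_le_mul_of_nonneg_left h2 hh]

/-- Lemma: for a `φ`-separated instance and a good private center set `B`, the means of the
clear-preference sets `X̂_i` are close to the optimal centers:
`‖c̄_i − c*_i‖² ≤ (r*_i)²·ρ/(1−ρ)` with `ρ = 100φ²/(1−φ²)`. -/
theorem stmt6 {d k : ℕ} (hk : 2 ≤ k) (φ w : ℝ) (hφ0 : 0 < φ) (hφ1 : φ < 1) (hw : 0 ≤ w)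
    (hcond : φ ^ 2 * (w + 1) / (1 - φ ^ 2) ≤ 1 / 784)
    (X : Multiset (EuclideanSpace ℝ (Fin d)))
    (hsep : kmOPT 2 k X ≤ φ ^ 2 * kmOPT 2 (k - 1) X)
    (Cstar : Fin k → EuclideanSpace ℝ (Fin d)) (hinj : Function.Injective Cstar)
    (hopt : kmcost 2 X Cstar = kmOPT 2 k X)
    (Xc : Fin k → Multiset (EuclideanSpace ℝ (Fin d)))
    (hpart : ∑ i, Xc i = X)
    (hassign : ∀ i, ∀ x ∈ Xc i, ∀ j, ‖x - Cstar i‖ ≤ ‖x - Cstar j‖)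
    (hne : ∀ i, Xc i ≠ 0)
    (B : Fin k → EuclideanSpace ℝ (Fin d)) (hBinj : Function.Injective B)
    (hB : kmcost 2 X B ≤ w * φ ^ 2 * kmOPT 2 (k - 1) X)
    (hBC : ∀ i, ‖B i - Cstar i‖ ≤
      2 * Real.sqrt (φ ^ 2 * (w + 1) / (1 - φ ^ 2)) * Dmin Cstar i) :
    ∀ i,
      (X.filter fun x => ‖x - B i‖ ≤ Dmin B i / 3) ≠ 0 ∧
      ‖mmean (X.filter fun x => ‖x - B i‖ ≤ Dmin B i / 3) - Cstar i‖ ^ 2 ≤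
        (((Xc i).card : ℝ)⁻¹ * (((Xc i).map fun y => ‖y - Cstar i‖ ^ 2).sum)) *
          (100 * φ ^ 2 / (1 - φ ^ 2)) / (1 - 100 * φ ^ 2 / (1 - φ ^ 2)) := by
  intro i
  subst hpart
  have hφ2 : 0 < 1 - φ ^ 2 := by nlinarith
  set q := φ ^ 2 / (1 - φ ^ 2) with hq
  have hq0 : 0 ≤ q := by positivity
  have hqle : q ≤ 1 / 784 := by
    refine le_trans ?_ hcond
    rw [hq]
    gcongr
    nlinarith [sq_nonneg φ]
  have hqφ : q * (1 - φ ^ 2) = φ ^ 2 := by rw [hq]; field_simp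
  have hρ : 100 * φ ^ 2 / (1 - φ ^ 2) = 100 * q := by rw [hq]; ring
  rw [hρ]
  have hγ : 2 * Real.sqrt (φ ^ 2 * (w + 1) / (1 - φ ^ 2)) ≤ 1 / 14 := by
    have : Real.sqrt (φ ^ 2 * (w + 1) / (1 - φ ^ 2)) ≤ 1 / 28 := by
      apply Real.sqrt_le_iff.2
      constructor
      · norm_num
      · refine hcond.trans (by norm_num)
    linarith
  have hsum : kmcost 2 (∑ i, Xc i) Cstar = ∑ j, SS (Xc j) (Cstar j) := by
    rw [kmcost_sum]
    exact Finset.sum_congr rfl fun j _ => kmcost_eq_SS _ _ _ (hassign j)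
  have hopt' := hsum.symm.trans hopt
  have hmean := centroid Cstar Xc hopt' i (hne i)
  have hmerge := merge hk Cstar Xc i hmean
  have hDpos : ∀ i, 0 < Dmin Cstar i := by
    intro i
    obtain ⟨j, hj, hD⟩ := Dmin_attained hk Cstar i
    rw [hD, norm_pos_iff, sub_ne_zero]
    exact fun h => hj (hinj h).symm
  have hb : ∀ j, ‖B j - Cstar j‖ ≤ Dmin Cstar j / 14 := by
    intro j
    refine (hBC j).trans ?_
    nlinarith [hDpos j, mul_le_mul_of_nonneg_right hγ (hDpos j).le]
  have hbi := hb i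
  have hD := hDpos i
  set D := Dmin Cstar i with hDdef
  -- lower bound
  have hlow : 6 / 7 * D ≤ Dmin B i := by
    obtain ⟨j, hj, hDj⟩ := Dmin_attained hk B i
    rw [hDj]
    have h1 := Dmin_le Cstar i j hj
    have h2 := Dmin_le Cstar j i hj.symm
    rw [norm_sub_rev] at h2
    have h3 := hb j
    have h4 : ‖Cstar i - Cstar j‖ ≤ ‖B i - Cstar i‖ + ‖B i - B j‖ + ‖B j - Cstar j‖ := by
      have : Cstar i - Cstar j = -(B i - Cstar i) + (B i - B j) + (B j - Cstar j) := by abel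
      rw [this]
      refine norm_add₃_le.trans ?_
      rw [norm_neg]
    linarith
  have hup : Dmin B i ≤ 8 / 7 * D := by
    obtain ⟨j, hj, hDj⟩ := Dmin_attained hk Cstar i
    have h1 := Dmin_le B i j hj
    have h2 := Dmin_le Cstar j i hj.symm
    rw [norm_sub_rev, ← hDj] at h2
    have h3 := hb j
    have h4 : ‖B i - B j‖ ≤ ‖B i - Cstar i‖ + ‖Cstar i - Cstar j‖ + ‖B j - Cstar j‖ := by
      have : B i - B j = (B i - Cstar i) + (Cstar i - Cstar j) + -(B j - Cstar j) := by abel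
      rw [this]
      refine norm_add₃_le.trans ?_
      rw [norm_neg]
    rw [← hDj] at h4
    linarith
  have hfil : (∑ j, Xc j).filter (fun x => ‖x - B i‖ ≤ Dmin B i / 3) =
      (Xc i).filter (fun x => ‖x - B i‖ ≤ Dmin B i / 3) := by
    rw [filter_sum']
    apply Finset.sum_eq_single_of_mem i (Finset.mem_univ i)
    intro j _ hj
    rw [Multiset.filter_eq_nil]
    intro x hx hxB
    have h1 := hassign j x hx i
    have h2 := Dmin_le Cstar i j hj
    have h3 : ‖x - Cstar i‖ ≤ ‖x - B i‖ + ‖B i - Cstar i‖ := norm_sub_le_norm_sub_add_norm_sub _ _ _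
    have h4 : ‖Cstar i - Cstar j‖ ≤ ‖Cstar i - x‖ + ‖x - Cstar j‖ :=
      norm_sub_le_norm_sub_add_norm_sub _ _ _
    rw [norm_sub_rev (Cstar i) x] at h4
    linarith
  rw [hfil]
  set H := (Xc i).filter (fun x => ‖x - B i‖ ≤ Dmin B i / 3) with hH
  set R := (Xc i).filter (fun x => ¬ ‖x - B i‖ ≤ Dmin B i / 3) with hR
  have hHR : H + R = Xc i := Multiset.filter_add_not _ _
  have hRc : (R.card : ℝ) * (9 / 196 * D ^ 2) ≤ SS R (Cstar i) := by
    have := Multiset.card_nsmul_le_sum (s := R.map fun x => ‖x - Cstar i‖ ^ 2)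
      (a := 9 / 196 * D ^ 2) (by
        intro y hy
        obtain ⟨x, hx, rfl⟩ := Multiset.mem_map.1 hy
        have hx2 := (Multiset.mem_filter.1 hx).2
        push Not at hx2
        have h3 : ‖x - B i‖ ≤ ‖x - Cstar i‖ + ‖Cstar i - B i‖ :=
          norm_sub_le_norm_sub_add_norm_sub _ _ _
        rw [norm_sub_rev (Cstar i)] at h3
        have h5 : 3 / 14 * D ≤ ‖x - Cstar i‖ := by linarith
        nlinarith)
    simpa [SS] using this
  set a := SS (Xc i) (Cstar i) with ha
  have haH : a = SS H (Cstar i) + SS R (Cstar i) := by rw [ha, ← hHR, SS_add]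
  have ha0 : 0 ≤ a := SS_nonneg _ _
  have hn : ((Xc i).card : ℝ) = H.card + R.card := by rw [← hHR, Multiset.card_add]; push_cast; rfl
  have hn0 : (0 : ℝ) < (Xc i).card := by exact_mod_cast Multiset.card_pos.2 (hne i)
  have haO : a ≤ ∑ j, SS (Xc j) (Cstar j) :=
    Finset.single_le_sum (f := fun j => SS (Xc j) (Cstar j)) (fun j _ => SS_nonneg _ _)
      (Finset.mem_univ i)
  have hsub := submean H R (Cstar i) (by rw [hHR]; exact hmean)
  rw [hHR, ← ha, ← hn] at hsub
  change _ ∧ _ ≤ (((Xc i).card : ℝ)⁻¹ * a) * _ / _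
  rw [← hopt'] at hsep
  set O := ∑ j, SS (Xc j) (Cstar j)
  set n : ℝ := ((Xc i).card : ℝ)
  set h : ℝ := (H.card : ℝ) with hh
  set r : ℝ := (R.card : ℝ)
  have hr0 : 0 ≤ r := by positivity
  have hO : O ≤ q * (n * D ^ 2) := by
    have : O ≤ φ ^ 2 * (O + n * D ^ 2) := hsep.trans (by gcongr)
    have h2 : (1 - φ ^ 2) * O ≤ (1 - φ ^ 2) * (q * (n * D ^ 2)) := by
      have : (1 - φ ^ 2) * (q * (n * D ^ 2)) = φ ^ 2 * (n * D ^ 2) := by linear_combination (n * D ^ 2) * hqφ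
      linarith
    exact le_of_mul_le_mul_left h2 hφ2
  have hrn : r ≤ 100 * q * n := by
    have h1 : (r * (9 / 196)) * D ^ 2 ≤ (q * n) * D ^ 2 := by
      have := SS_nonneg H (Cstar i)
      linarith
    have h2 := le_of_mul_le_mul_right h1 (by positivity)
    have : 0 ≤ q * n := by positivity
    linarith
  have hqn : q * n ≤ 1 / 784 * n := by gcongr
  have hhn : (1 - 100 * q) * n ≤ h := by linarith
  have hh0 : 0 < h := by linarith
  have hH0 : H ≠ 0 := by
    intro h0
    rw [hh, h0] at hh0
    simp at hh0
  refine ⟨hH0, ?_⟩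
  have e1 : H.sum - h • Cstar i = h • (mmean H - Cstar i) := by
    rw [smul_sub, ← sum_eq_mmean]
  rw [e1, norm_smul, mul_pow, Real.norm_of_nonneg hh0.le] at hsub
  set z := ‖mmean H - Cstar i‖ ^ 2
  have hz0 : 0 ≤ z := by positivity
  have h1 : n * h * z ≤ r * a := by
    have : h * (n * h * z) ≤ h * (r * a) := by linarith
    exact le_of_mul_le_mul_left this hh0
  have hq1 : 0 < 1 - 100 * q := by linarith
  rw [le_div_iff₀ hq1]
  have h2 : n * n * (z * (1 - 100 * q)) ≤ n * n * (n⁻¹ * a * (100 * q)) := by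
    calc n * n * (z * (1 - 100 * q)) = n * ((1 - 100 * q) * n) * z := by ring
      _ ≤ n * h * z := by gcongr
      _ ≤ r * a := h1
      _ ≤ 100 * q * n * a := by gcongr
      _ = n * n * (n⁻¹ * a * (100 * q)) := by field_simp
  exact le_of_mul_le_mul_left h2 (by positivity)
end

section
/- Let C* and B be finite nonempty sets of points in ℝ^d, and for a finite set A and a point y let A(y) denote a fixed nearest point of A to y. Let 0 ≤ γ < 1/4, and for c ∈ C* with |C*| ≥ 2 let D(c) = min_{c'∈C*, c'≠c} ‖c − c'‖. Assume that ‖c − B(c)‖ ≤ γ·D(c) for every c ∈ C*, and that ‖b − C*(b)‖ ≤ γ·D(C*(b)) for every b ∈ B. Then for every x ∈ ℝ^d with C*(x) ≠ C*(B(x)), ‖x − C*(B(x))‖ ≤ (1 + 4γ/(1−4γ))·‖x − C*(x)‖. -/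
open scoped BigOperators Classical

/-- `Dsep Cs c = min_{c' ∈ Cs, c' ≠ c} ‖c - c'‖`. -/
noncomputable def Dsep {d : ℕ} (Cs : Finset (EuclideanSpace ℝ (Fin d)))
    (c : EuclideanSpace ℝ (Fin d)) : ℝ :=
  sInf ((fun c' => ‖c - c'‖) '' {c' | c' ∈ Cs ∧ c' ≠ c})

/-- If the centers of `C*` and `B` are mutually `γ·D`-close (with `0 ≤ γ < 1/4`), then for every
point `x` with `C*(x) ≠ C*(B(x))` we have
`‖x − C*(B(x))‖ ≤ (1 + 4γ/(1−4γ))·‖x − C*(x)‖`. -/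
theorem stmt10 {d : ℕ} (Cs Bs : Finset (EuclideanSpace ℝ (Fin d)))
    (hCs : Cs.Nonempty) (hBs : Bs.Nonempty) (hCcard : 2 ≤ Cs.card)
    (nC nB : EuclideanSpace ℝ (Fin d) → EuclideanSpace ℝ (Fin d))
    (hnC : ∀ y, nC y ∈ Cs ∧ ∀ c ∈ Cs, ‖y - nC y‖ ≤ ‖y - c‖)
    (hnB : ∀ y, nB y ∈ Bs ∧ ∀ b ∈ Bs, ‖y - nB y‖ ≤ ‖y - b‖)
    (γ : ℝ) (hγ0 : 0 ≤ γ) (hγ : γ < 1 / 4)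
    (hCB : ∀ c ∈ Cs, ‖c - nB c‖ ≤ γ * Dsep Cs c)
    (hBC : ∀ b ∈ Bs, ‖b - nC b‖ ≤ γ * Dsep Cs (nC b)) :
    ∀ x : EuclideanSpace ℝ (Fin d), nC x ≠ nC (nB x) →
      ‖x - nC (nB x)‖ ≤ (1 + 4 * γ / (1 - 4 * γ)) * ‖x - nC x‖ := by
  intro x hx
  have hD : ∀ c c' : EuclideanSpace ℝ (Fin d), c' ∈ Cs → c' ≠ c → Dsep Cs c ≤ ‖c - c'‖ := by
    intro c c' h1 h2
    refine csInf_le ⟨0, ?_⟩ ⟨c', ⟨h1, h2⟩, rfl⟩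
    rintro _ ⟨z, _, rfl⟩
    exact norm_nonneg _
  have h1 := hCB _ (hnC x).1
  have h2 := hBC _ (hnB x).1
  have h3 := (hnB x).2 _ (hnB (nC x)).1
  have d1 := hD (nC x) (nC (nB x)) (hnC _).1 hx.symm
  have d2 := hD (nC (nB x)) (nC x) (hnC _).1 hx
  rw [norm_sub_rev (nC (nB x)) (nC x)] at d2
  have t1 := norm_sub_le_norm_sub_add_norm_sub x (nB x) (nC (nB x))
  have t2 := norm_sub_le_norm_sub_add_norm_sub x (nC x) (nB (nC x))
  have t3 := norm_sub_le_norm_sub_add_norm_sub (nC x) x (nC (nB x))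
  rw [norm_sub_rev (nC x) x] at t3
  have e1 := mul_le_mul_of_nonneg_left (d1.trans t3) hγ0
  have e2 := mul_le_mul_of_nonneg_left (d2.trans t3) hγ0
  have hr : 0 ≤ ‖x - nC x‖ := norm_nonneg _
  generalize ‖x - nC x‖ = r at *
  generalize ‖x - nC (nB x)‖ = s at *
  have key : s ≤ r + 2 * (γ * (r + s)) := by linarith
  have h4 : 0 < 1 - 4 * γ := by linarith
  have e : 1 + 4 * γ / (1 - 4 * γ) = 1 / (1 - 4 * γ) := by
    field_simp
    ring
  rw [e, one_div_mul_eq_div, le_div_iff₀ h4]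
  have h5 : 0 < 1 - 2 * γ := by linarith
  refine le_of_mul_le_mul_left ?_ h5
  have h6 : (1 - 2 * γ) * s ≤ (1 + 2 * γ) * r := by linarith
  have h7 := mul_le_mul_of_nonneg_right h6 h4.le
  have h8 : 0 ≤ γ ^ 2 * r := by positivity
  nlinarith
end

section
/- Let X be a finite multiset of points in ℝ^d, let C* = {c*₁,…,c*_k} (k ≥ 2) be an optimal k-median center set for X, and let B be a set of k centers. For a finite set A and a point y let A(y) denote a fixed nearest point of A to y, and for c ∈ C* let D(c) = min_{c'∈C*, c'≠c} ‖c − c'‖. Let 0 ≤ γ < 1/4 and assume ‖c − B(c)‖ ≤ γ·D(c) for every c ∈ C* and ‖b − C*(b)‖ ≤ γ·D(C*(b)) for every b ∈ B. Then the cost of assigning every x ∈ X to the optimal center nearest to its nearest point in B satisfies ∑_{x∈X} ‖x − C*(B(x))‖ ≤ (1 + 4γ/(1−4γ))·OPT¹_k(X). -/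
open scoped BigOperators Classical

/-- If `C*` is an optimal `k`-median center set and `B` a set of `k` centers with the centers of
`C*` and `B` mutually `γ·D`-close (`0 ≤ γ < 1/4`), then assigning every `x ∈ X` to the optimal
center nearest to its nearest point of `B` costs at most `(1 + 4γ/(1−4γ))·OPT¹_k(X)`. -/
theorem stmt11 {d k : ℕ} (hk : 2 ≤ k)
    (X : Multiset (EuclideanSpace ℝ (Fin d)))
    (Cs Bs : Finset (EuclideanSpace ℝ (Fin d)))
    (hCcard : Cs.card = k) (hBcard : Bs.card = k)
    (nC nB : EuclideanSpace ℝ (Fin d) → EuclideanSpace ℝ (Fin d))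
    (hnC : ∀ y, nC y ∈ Cs ∧ ∀ c ∈ Cs, ‖y - nC y‖ ≤ ‖y - c‖)
    (hnB : ∀ y, nB y ∈ Bs ∧ ∀ b ∈ Bs, ‖y - nB y‖ ≤ ‖y - b‖)
    (hopt : (X.map fun x => ‖x - nC x‖).sum = kmOPT 1 k X)
    (γ : ℝ) (hγ0 : 0 ≤ γ) (hγ : γ < 1 / 4)
    (hCB : ∀ c ∈ Cs, ‖c - nB c‖ ≤ γ * Dsep Cs c)
    (hBC : ∀ b ∈ Bs, ‖b - nC b‖ ≤ γ * Dsep Cs (nC b)) :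
    (X.map fun x => ‖x - nC (nB x)‖).sum ≤
      (1 + 4 * γ / (1 - 4 * γ)) * kmOPT 1 k X := by
  have hD : ∀ c c', c' ∈ Cs → c' ≠ c → Dsep Cs c ≤ ‖c - c'‖ := by
    intro c c' h1 h2
    refine csInf_le ⟨0, ?_⟩ ⟨c', ⟨h1, h2⟩, rfl⟩
    rintro _ ⟨y, _, rfl⟩
    exact norm_nonneg _
  have hpos : 0 < 1 - 4 * γ := by linarith
  have hfac : 1 + 4 * γ / (1 - 4 * γ) = 1 / (1 - 4 * γ) := by
    field_simp
    ring
  rw [← hopt, ← Multiset.sum_map_mul_left]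
  apply Multiset.sum_map_le_sum_map
  intro x _
  rw [hfac, div_mul_eq_mul_div, one_mul, le_div_iff₀ hpos]
  have hr := norm_nonneg (x - nC x)
  by_cases h : nC (nB x) = nC x
  · rw [h]
    nlinarith [mul_nonneg hγ0 hr]
  have hoC := (hnC x).1
  have hcC := (hnC (nB x)).1
  have h1 := hD _ _ hcC h
  have h2 := hD _ _ hoC (Ne.symm h)
  have h3 := hCB _ hoC
  have h4 := hBC _ (hnB x).1
  have h5 := (hnB x).2 _ (hnB (nC x)).1
  have h6 := norm_sub_le_norm_sub_add_norm_sub x (nC x) (nB (nC x))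
  have h7 := norm_sub_le_norm_sub_add_norm_sub x (nB x) (nC (nB x))
  have h8 := norm_sub_le_norm_sub_add_norm_sub (nC x) x (nC (nB x))
  rw [norm_sub_rev (nC x) x] at h8
  rw [norm_sub_rev (nC (nB x)) (nC x)] at h2
  have h9 := mul_le_mul_of_nonneg_left (h1.trans h8) hγ0
  have h10 := mul_le_mul_of_nonneg_left (h2.trans h8) hγ0
  have h11 := (hnC x).2 _ hcC
  have h12 : ‖x - nC (nB x)‖ ≤ ‖x - nC x‖ + 2 * (γ * (‖x - nC x‖ + ‖x - nC (nB x)‖)) := by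
    linarith
  have h13 := mul_le_mul_of_nonneg_left h11 hγ0
  linarith
end

section
/- Let X be a finite nonempty multiset of points in ℝ^d and let S ⊆ X be a nonempty sub-multiset. Let c denote the mean of X and s the mean of S. Then ‖s − c‖² ≤ (OPT²₁(X)/|X|)·(|X∖S|/|S|), where OPT²₁(X) = ∑_{x∈X} ‖x − c‖². -/
open scoped BigOperators Classical

lemma aux_cs {E : Type*} [NormedAddCommGroup E] (f : E → E) (S : Multiset E) :
    ‖(S.map f).sum‖ ^ 2 ≤ (S.card : ℝ) * (S.map fun x => ‖f x‖ ^ 2).sum := by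
  induction S using Multiset.induction_on with
  | empty => simp
  | cons a S ih =>
    simp only [Multiset.map_cons, Multiset.sum_cons, Multiset.card_cons, Nat.cast_add, Nat.cast_one]
    have hQ : 0 ≤ (S.map fun x => ‖f x‖ ^ 2).sum := by
      apply Multiset.sum_nonneg
      intro y hy
      obtain ⟨x, _, rfl⟩ := Multiset.mem_map.1 hy
      positivity
    have hn : (0 : ℝ) ≤ S.card := Nat.cast_nonneg _
    have ht := norm_add_le (f a) (S.map f).sum
    have h0 := norm_nonneg (f a + (S.map f).sum)
    have hv := norm_nonneg (f a)
    have hw := norm_nonneg (S.map f).sum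
    generalize (S.map fun x => ‖f x‖ ^ 2).sum = Q at *
    generalize (S.card : ℝ) = n at *
    generalize ‖f a + (S.map f).sum‖ = z at *
    generalize ‖f a‖ = v at *
    generalize ‖(S.map f).sum‖ = w at *
    have key : 2 * v * w ≤ n * v ^ 2 + Q := by
      refine abs_le_of_sq_le_sq' ?_ (by positivity) |>.2
      nlinarith [sq_nonneg (n * v ^ 2 - Q), mul_le_mul_of_nonneg_left ih (sq_nonneg v)]
    have : z ^ 2 ≤ (v + w) ^ 2 := by gcongr
    nlinarith

lemma aux_sum {E : Type*} [NormedAddCommGroup E] [NormedSpace ℝ E] (c : E) (S : Multiset E) :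
    (S.map fun x => x - c).sum = S.sum - (S.card : ℝ) • c := by
  induction S using Multiset.induction_on with
  | empty => simp
  | cons a S ih =>
    simp only [Multiset.map_cons, Multiset.sum_cons, Multiset.card_cons, Nat.cast_add,
      Nat.cast_one, ih, add_smul, one_smul]
    abel

/-- Lemma 2.3 of Ostrovsky et al.: the mean of a nonempty sub-multiset `S ⊆ X` satisfies
`‖s − c‖² ≤ (OPT²₁(X)/|X|)·(|X∖S|/|S|)`. -/
theorem stmt16 {d : ℕ} (X S : Multiset (EuclideanSpace ℝ (Fin d)))
    (hX : X ≠ 0) (hS : S ≠ 0) (hSX : S ≤ X) :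
    ‖mmean S - mmean X‖ ^ 2 ≤
      ((X.map fun x => ‖x - mmean X‖ ^ 2).sum / (X.card : ℝ)) *
        (((X - S).card : ℝ) / (S.card : ℝ)) := by
  obtain ⟨T, rfl⟩ := Multiset.le_iff_exists_add.1 hSX
  have ha : (0 : ℝ) < S.card := by exact_mod_cast Multiset.card_pos.2 hS
  have hb : (0 : ℝ) ≤ T.card := Nat.cast_nonneg _
  rw [add_tsub_cancel_left]
  have hc : (((S + T).card : ℕ) : ℝ) • mmean (S + T) = (S + T).sum := by
    unfold mmean
    rw [smul_smul, mul_inv_cancel₀, one_smul]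
    rw [Multiset.card_add, Nat.cast_add]
    positivity
  generalize mmean (S + T) = c at *
  have h1 := aux_cs (fun x => x - c) S
  have h2 := aux_cs (fun x => x - c) T
  have hu : (T.map fun x => x - c).sum = - (S.map fun x => x - c).sum := by
    rw [eq_neg_iff_add_eq_zero, aux_sum, aux_sum]
    rw [Multiset.card_add, Nat.cast_add, add_smul, Multiset.sum_add] at hc
    rw [sub_add_sub_comm, add_comm T.sum, ← hc]
    abel
  have hs : mmean S - c = (S.card : ℝ)⁻¹ • (S.map fun x => x - c).sum := by
    rw [aux_sum, smul_sub, smul_smul, inv_mul_cancel₀ ha.ne', one_smul, mmean]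
  rw [hu, norm_neg] at h2
  rw [hs, norm_smul, norm_inv, Real.norm_of_nonneg ha.le, Multiset.map_add, Multiset.sum_add,
    Multiset.card_add, Nat.cast_add]
  generalize ‖(S.map fun x => x - c).sum‖ = u at *
  generalize (S.map fun x => ‖x - c‖ ^ 2).sum = A at *
  generalize (T.map fun x => ‖x - c‖ ^ 2).sum = B at *
  generalize (S.card : ℝ) = a at *
  generalize (T.card : ℝ) = b at *
  rw [div_mul_div_comm, mul_pow, inv_pow, inv_mul_eq_div, div_le_div_iff₀ (by positivity) (by positivity)]
  have key : u ^ 2 * (a + b) ≤ (A + B) * b * a := by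
    nlinarith [mul_le_mul_of_nonneg_left h1 hb, mul_le_mul_of_nonneg_left h2 ha.le]
  nlinarith [mul_le_mul_of_nonneg_left key ha.le]
end
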